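/- The dihedral group D₁₀ of order 10 is a 5-BCI-group: every bi-Cayley graph BCay(D₁₀, S) with |S| ≤ 5 is a BCI-graph. -/

import Mathlib

open SimpleGraph

/-- The bi-Cayley graph `BCay(G,S)`: vertex set `G × {1,2}` (encoded as `G × Fin 2`,
where index `0` stands for part `1` and index `1` for part `2`), with edges
`{(g,1),(sg,2)}` for `g ∈ G`, `s ∈ S`. -/
def BCay (G : Type*) [Group G] (S : Set G) : SimpleGraph (G × Fin 2) :=
  SimpleGraph.fromRel (fun u v => u.2 = 0 ∧ v.2 = 1 ∧ v.1 * u.1⁻¹ ∈ S)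

/-- `BCay(G,S)` is a BCI-graph. -/
def IsBCIGraph (G : Type*) [Group G] (S : Set G) : Prop :=
  ∀ T : Set G, Nonempty (BCay G S ≃g BCay G T) →
    ∃ (g : G) (α : G ≃* G), T = (fun s => g * α s) '' S

/-- `G` is a BCI-group. -/
def IsBCIGroup (G : Type*) [Group G] : Prop :=
  ∀ S : Set G, IsBCIGraph G S

/-- `G` is an `m`-BCI-group. -/
def IsmBCIGroup (G : Type*) [Group G] (m : ℕ) : Prop :=
  ∀ S : Set G, S.ncard ≤ m → IsBCIGraph G S

/-- The Cayley graph `Cay(G,S)`, for `1 ∉ S = S⁻¹`. -/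
def Cay (G : Type*) [Group G] (S : Set G) : SimpleGraph G :=
  SimpleGraph.fromRel (fun x y => y * x⁻¹ ∈ S)

/-- `Cay(G,S)` is a CI-graph. -/
def IsCIGraph (G : Type*) [Group G] (S : Set G) : Prop :=
  ∀ T : Set G, 1 ∉ T → T⁻¹ = T → Nonempty (Cay G S ≃g Cay G T) →
    ∃ α : G ≃* G, T = α '' S

/-- `G` is a CI-group. -/
def IsCIGroup (G : Type*) [Group G] : Prop :=
  ∀ S : Set G, 1 ∉ S → S⁻¹ = S → IsCIGraph G S

/-- `G` is an `m`-CI-group. -/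
def IsmCIGroup (G : Type*) [Group G] (m : ℕ) : Prop :=
  ∀ S : Set G, 1 ∉ S → S⁻¹ = S → S.ncard ≤ m → IsCIGraph G S

open Finset

section Codegree

variable {V W : Type*}

/-- The number of common neighbours of `u` and `v`. -/
noncomputable def codegree (Γ : SimpleGraph V) (u v : V) : ℕ :=
  Nat.card {w // Γ.Adj u w ∧ Γ.Adj v w}

/-- The number of closed walks of length `6`, that is, the trace of the sixth power of the
adjacency matrix. -/
noncomputable def closedSixWalks [Fintype V] (Γ : SimpleGraph V) : ℕ :=
  ∑ u, ∑ v, ∑ w, codegree Γ u v * codegree Γ v w * codegree Γ w u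

theorem codegree_map {Γ : SimpleGraph V} {Δ : SimpleGraph W} (e : Γ ≃g Δ) (u v : V) :
    codegree Δ (e u) (e v) = codegree Γ u v :=
  Nat.card_congr (e.toEquiv.subtypeEquiv fun w => by
    change _ ↔ Δ.Adj (e u) (e w) ∧ Δ.Adj (e v) (e w)
    rw [e.map_adj_iff, e.map_adj_iff]).symm

theorem closedSixWalks_congr [Fintype V] [Fintype W] {Γ : SimpleGraph V} {Δ : SimpleGraph W}
    (e : Γ ≃g Δ) :
    closedSixWalks Γ = closedSixWalks Δ := by
  unfold closedSixWalks
  refine Fintype.sum_equiv e.toEquiv _ _ fun u => Fintype.sum_equiv e.toEquiv _ _ fun v =>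
    Fintype.sum_equiv e.toEquiv _ _ fun w => ?_
  change _ = codegree Δ (e u) (e v) * codegree Δ (e v) (e w) * codegree Δ (e w) (e u)
  simp only [codegree_map]

end Codegree

section BiCayley

variable {G : Type*} [Group G]

theorem BCay_adj_zero_one {S : Set G} {x y : G} :
    (BCay G S).Adj (x, 0) (y, 1) ↔ y * x⁻¹ ∈ S := by
  simp [BCay]

theorem BCay_adj_one_zero {S : Set G} {x y : G} :
    (BCay G S).Adj (x, 1) (y, 0) ↔ x * y⁻¹ ∈ S := by
  simp [BCay]

theorem not_BCay_adj_same {S : Set G} {x y : G} {i : Fin 2} :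
    ¬ (BCay G S).Adj (x, i) (y, i) := by
  fin_cases i <;> simp [BCay]

/-- The equivalence of subsets of `G` under the maps `s ↦ g * α s`. -/
def AffineEquivalent (S T : Set G) : Prop :=
  ∃ (g : G) (α : G ≃* G), T = (fun s => g * α s) '' S

namespace AffineEquivalent

theorem symm {S T : Set G} : AffineEquivalent S T → AffineEquivalent T S := by
  rintro ⟨g, α, rfl⟩
  exact ⟨α.symm g⁻¹, α.symm, by simp [Set.image_image]⟩

theorem trans {S T U : Set G} :
    AffineEquivalent S T → AffineEquivalent T U → AffineEquivalent S U := by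
  rintro ⟨g, α, rfl⟩ ⟨h, β, rfl⟩
  exact ⟨h * β g, α.trans β, by simp [Set.image_image, mul_assoc]⟩

theorem nonempty_iso {S T : Set G} :
    AffineEquivalent S T → Nonempty (BCay G S ≃g BCay G T) := by
  rintro ⟨g, α, rfl⟩
  have key (x y : G) : g * α y * (α x)⁻¹ ∈ (fun s => g * α s) '' S ↔ y * x⁻¹ ∈ S := by
    rw [mul_assoc, ← map_inv, ← map_mul]
    exact Function.Injective.mem_set_image
      (f := fun s => g * α s) ((mul_right_injective g).comp α.injective)
  refine ⟨⟨(Equiv.prodComm _ _).trans ((Equiv.prodShear (Equiv.refl (Fin 2)) fun i =>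
    α.toEquiv.trans (Equiv.mulLeft (if i = 0 then 1 else g))).trans (Equiv.prodComm _ _)), ?_⟩⟩
  rintro ⟨x, i⟩ ⟨y, j⟩
  fin_cases i <;> fin_cases j <;>
    simp [not_BCay_adj_same, BCay_adj_zero_one, BCay_adj_one_zero, key]

end AffineEquivalent

theorem codegree_BCay_of_ne (S : Set G) (x y : G) {i j : Fin 2} (hij : i ≠ j) :
    codegree (BCay G S) (x, i) (y, j) = 0 := by
  have : IsEmpty {w // (BCay G S).Adj (x, i) w ∧ (BCay G S).Adj (y, j) w} := by
    refine ⟨?_⟩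
    rintro ⟨⟨z, k⟩, h₁, h₂⟩
    obtain rfl | rfl : k = i ∨ k = j := by omega
    · exact not_BCay_adj_same h₁
    · exact not_BCay_adj_same h₂
  exact Nat.card_of_isEmpty

theorem sum_triangle [Fintype G] (k : G → ℕ) :
    ∑ x, ∑ y, ∑ z, k (x * y⁻¹) * k (y * z⁻¹) * k (z * x⁻¹) =
      Fintype.card G * ∑ u, ∑ v, k u * k v * k (u * v)⁻¹ := by
  rw [← smul_eq_mul, ← Finset.card_univ, ← Finset.sum_const]
  refine Finset.sum_congr rfl fun x _ => ?_
  refine Fintype.sum_equiv ((Equiv.inv G).trans (Equiv.mulLeft x)) _ _ fun y => ?_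
  refine Fintype.sum_equiv ((Equiv.inv G).trans (Equiv.mulLeft y)) _ _ fun z => ?_
  simp [mul_assoc]

variable [DecidableEq G]

/-- The number of solutions of `t = s * w` with `s, t ∈ S`. -/
def rightQuotientCount (S : Finset G) (w : G) : ℕ := #{s ∈ S | s * w ∈ S}

/-- The number of solutions of `t = w * s` with `s, t ∈ S`. -/
def leftQuotientCount (S : Finset G) (w : G) : ℕ := #{s ∈ S | w * s ∈ S}

theorem codegree_BCay_zero (S : Finset G) (x y : G) :
    codegree (BCay G S) (x, 0) (y, 0) = rightQuotientCount S (x * y⁻¹) := by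
  rw [rightQuotientCount, ← Fintype.card_coe, ← Nat.card_eq_fintype_card]
  refine Nat.card_congr ⟨fun w => ⟨w.1.1 * x⁻¹, ?_⟩, fun s => ⟨(s.1 * x, 1), ?_⟩, ?_, ?_⟩
  · obtain ⟨⟨z, i⟩, h⟩ := w
    fin_cases i
    · exact absurd h.1 not_BCay_adj_same
    · simpa [BCay_adj_zero_one] using h
  · simpa [BCay_adj_zero_one, mul_assoc] using Finset.mem_filter.1 s.2
  · rintro ⟨⟨z, i⟩, h⟩
    fin_cases i
    · exact absurd h.1 not_BCay_adj_same
    · simp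
  · intro s
    simp

theorem codegree_BCay_one (S : Finset G) (x y : G) :
    codegree (BCay G S) (x, 1) (y, 1) = leftQuotientCount S (x * y⁻¹) := by
  rw [leftQuotientCount, ← Fintype.card_coe, ← Nat.card_eq_fintype_card]
  refine Nat.card_congr ⟨fun w => ⟨y * w.1.1⁻¹, ?_⟩, fun s => ⟨(s.1⁻¹ * y, 0), ?_⟩, ?_, ?_⟩
  · obtain ⟨⟨z, i⟩, h⟩ := w
    fin_cases i
    · simpa [BCay_adj_one_zero, mul_assoc, and_comm] using h
    · exact absurd h.1 not_BCay_adj_same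
  · simpa [BCay_adj_one_zero, mul_assoc, and_comm] using Finset.mem_filter.1 s.2
  · rintro ⟨⟨z, i⟩, h⟩
    fin_cases i
    · simp
    · exact absurd h.1 not_BCay_adj_same
  · intro s
    simp

variable [Fintype G]

/-- The number of closed walks of length `6` in `BCay G S` through a given vertex of the first
part plus the number of those through a given vertex of the second part. -/
def rootedSixWalks (S : Finset G) : ℕ :=
  (∑ u, ∑ v, rightQuotientCount S u * rightQuotientCount S v * rightQuotientCount S (u * v)⁻¹) +
    ∑ u, ∑ v, leftQuotientCount S u * leftQuotientCount S v * leftQuotientCount S (u * v)⁻¹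

theorem closedSixWalks_BCay (S : Finset G) :
    closedSixWalks (BCay G S) = Fintype.card G * rootedSixWalks S := by
  rw [rootedSixWalks, mul_add, ← sum_triangle, ← sum_triangle]
  have h01 (x y : G) := codegree_BCay_of_ne (S : Set G) x y (i := 0) (j := 1) (by decide)
  have h10 (x y : G) := codegree_BCay_of_ne (S : Set G) x y (i := 1) (j := 0) (by decide)
  simp only [closedSixWalks, Fintype.sum_prod_type, Fin.sum_univ_two, codegree_BCay_zero,
    codegree_BCay_one, h01, h10, zero_mul, mul_zero, add_zero, zero_add,
    Finset.sum_add_distrib, Finset.sum_const_zero]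

theorem rootedSixWalks_eq_of_iso {S T : Finset G}
    (e : BCay G S ≃g BCay G T) : rootedSixWalks S = rootedSixWalks T := by
  have h := closedSixWalks_congr e
  rw [closedSixWalks_BCay, closedSixWalks_BCay] at h
  exact Nat.eq_of_mul_eq_mul_left Fintype.card_pos h

end BiCayley

namespace DihedralGroup

/-- The automorphism `r i ↦ r (u * i)`, `sr i ↦ sr (u * i + c)` of the dihedral group. -/
def affineAut {n : ℕ} (u : (ZMod n)ˣ) (c : ZMod n) : DihedralGroup n ≃* DihedralGroup n where
  toFun
    | r i => r (u * i)
    | sr i => sr (u * i + c)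
  invFun
    | r i => r (u⁻¹ * i)
    | sr i => sr (u⁻¹ * (i - c))
  left_inv x := by cases x <;> simp
  right_inv x := by cases x <;> simp
  map_mul' x y := by
    cases x <;> cases y <;> simp <;> ring

/-- The subset of the dihedral group with rotations indexed by `A` and reflections
indexed by `B`. -/
def ofIndices {n : ℕ} (A B : Finset (ZMod n)) : Finset (DihedralGroup n) :=
  A.image r ∪ B.image sr

theorem exists_eq_ofIndices {n : ℕ} [NeZero n] (S : Set (DihedralGroup n)) :
    ∃ A B : Finset (ZMod n), S = ofIndices A B := by
  classical
  refine ⟨univ.filter (r · ∈ S), univ.filter (sr · ∈ S), ?_⟩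
  ext (i | i) <;> simp [ofIndices]

theorem affineEquivalent_ofIndices {n : ℕ} (A B : Finset (ZMod n)) (u : (ZMod n)ˣ)
    (c d : ZMod n) :
    AffineEquivalent (ofIndices A B : Set (DihedralGroup n))
      (ofIndices (A.image ((u : ZMod n) * · + c)) (B.image ((u : ZMod n) * · + d))) := by
  refine ⟨r c, affineAut u (d + c), ?_⟩
  simp only [ofIndices, Finset.coe_union, Finset.coe_image, Set.image_union, Set.image_image]
  simp [affineAut, add_sub_assoc, add_comm c]

theorem affineEquivalent_ofIndices_swap {n : ℕ} (A B : Finset (ZMod n)) :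
    AffineEquivalent (ofIndices A B : Set (DihedralGroup n)) (ofIndices B A) := by
  refine ⟨sr 0, MulEquiv.refl _, ?_⟩
  simp [ofIndices, Set.image_union, Set.image_image, Set.union_comm]

/-- The residues of `0, …, k - 1` modulo `5`. -/
def initialResidues (k : ℕ) : Finset (ZMod 5) := (Finset.range k).image Nat.cast

/-- The set of the residues `0, u, …, (k - 1) * u` modulo `5`. -/
def multiples (k : ℕ) (u : ZMod 5) : Finset (ZMod 5) := (initialResidues k).image (u * ·)

/-- The subset of the dihedral group with rotations indexed by `0, …, k - 1` and reflections
indexed by `0, u, …, (l - 1) * u`, for `p = (k, l, u)`. -/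
def ofTriple (p : ℕ × ℕ × ZMod 5) : Finset (DihedralGroup 5) :=
  ofIndices (initialResidues p.1) (multiples p.2.1 p.2.2)

/-- The triples `(k, l, u)` whose sets `ofTriple (k, l, u)` represent the subsets of
`DihedralGroup 5` up to affine equivalence. -/
def representatives : List (ℕ × ℕ × ZMod 5) :=
  ((List.range 6 ×ˢ List.range 6).filter fun p => p.1 ≤ p.2).map (fun p => (p.1, p.2, 1)) ++
    [(2, 2, 2), (2, 3, 2), (3, 3, 2)]

theorem exists_eq_image_initialResidues : ∀ A : Finset (ZMod 5),
    ∃ (k : Fin 6) (u : (ZMod 5)ˣ) (c : ZMod 5),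
      A = (initialResidues k).image ((u : ZMod 5) * · + c) := by
  decide +kernel

/-- The sets `A'` and `B'` are translates of `u * A` and `u * B` for a common unit `u`. -/
def IsRescaling (A B A' B' : Finset (ZMod 5)) : Prop :=
  ∃ u : (ZMod 5)ˣ, (∃ c, A.image ((u : ZMod 5) * · + c) = A') ∧
    ∃ d, B.image ((u : ZMod 5) * · + d) = B'

instance (A B A' B' : Finset (ZMod 5)) : Decidable (IsRescaling A B A' B') :=
  inferInstanceAs (Decidable (∃ _, _))

theorem IsRescaling.affineEquivalent {A B A' B' : Finset (ZMod 5)}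
    (h : IsRescaling A B A' B') :
    AffineEquivalent (ofIndices A B : Set (DihedralGroup 5)) (ofIndices A' B') := by
  obtain ⟨u, ⟨c, rfl⟩, d, rfl⟩ := h
  exact affineEquivalent_ofIndices A B u c d

theorem exists_representative_multiples : ∀ (k l : Fin 6) (w : (ZMod 5)ˣ), ∃ v : ZMod 5,
    ((k.val, l.val, v) ∈ representatives ∧
      IsRescaling (initialResidues k) (multiples l v) (initialResidues k) (multiples l w)) ∨
    ((l.val, k.val, v) ∈ representatives ∧
      IsRescaling (multiples k v) (initialResidues l) (initialResidues k) (multiples l w)) := by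
  decide +kernel

theorem exists_affineEquivalent_representative (S : Set (DihedralGroup 5)) :
    ∃ p ∈ representatives, AffineEquivalent (ofTriple p : Set (DihedralGroup 5)) S := by
  obtain ⟨A, B, rfl⟩ := exists_eq_ofIndices S
  obtain ⟨k, u, c, rfl⟩ := exists_eq_image_initialResidues A
  obtain ⟨l, v, d, rfl⟩ := exists_eq_image_initialResidues B
  have h := affineEquivalent_ofIndices (initialResidues k)
    (multiples l (u⁻¹ * v : (ZMod 5)ˣ)) u c d
  simp only [multiples, Finset.image_image, Function.comp_def, ← mul_assoc, ← Units.val_mul,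
    mul_inv_cancel, one_mul] at h
  obtain ⟨w, ⟨hp, h'⟩ | ⟨hp, h'⟩⟩ := exists_representative_multiples k l (u⁻¹ * v)
  · exact ⟨_, hp, h'.affineEquivalent.trans h⟩
  · exact ⟨_, hp, (affineEquivalent_ofIndices_swap ..).trans (h'.affineEquivalent.trans h)⟩

/-- The function `k`, with its argument brought to normal form, so that the kernel computes each
value of `k` only once. -/
def tabulate (k : DihedralGroup 5 → ℕ) : DihedralGroup 5 → ℕ
  | r i => [k (r 0), k (r 1), k (r 2), k (r 3), k (r 4)].getD i.val 0
  | sr i => [k (sr 0), k (sr 1), k (sr 2), k (sr 3), k (sr 4)].getD i.val 0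

theorem tabulate_eq (k : DihedralGroup 5 → ℕ) : tabulate k = k := by
  ext (i | i) <;> fin_cases i <;> rfl

theorem rootedSixWalks_eq_tabulate (S : Finset (DihedralGroup 5)) :
    rootedSixWalks S =
      (∑ u, ∑ v, tabulate (rightQuotientCount S) u * tabulate (rightQuotientCount S) v *
        tabulate (rightQuotientCount S) (u * v)⁻¹) +
      ∑ u, ∑ v, tabulate (leftQuotientCount S) u * tabulate (leftQuotientCount S) v *
        tabulate (leftQuotientCount S) (u * v)⁻¹ := by
  simp only [tabulate_eq, rootedSixWalks]

theorem nodup_map_rootedSixWalks_representatives :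
    (representatives.map fun p => rootedSixWalks (ofTriple p)).Nodup := by
  simp only [rootedSixWalks_eq_tabulate]
  decide +kernel

theorem isBCIGroup_five : IsBCIGroup (DihedralGroup 5) := by
  rintro S T ⟨e⟩
  obtain ⟨p, hp, hS⟩ := exists_affineEquivalent_representative S
  obtain ⟨q, hq, hT⟩ := exists_affineEquivalent_representative T
  obtain ⟨f⟩ := hS.nonempty_iso
  obtain ⟨g⟩ := hT.nonempty_iso
  obtain rfl : p = q := List.inj_on_of_nodup_map nodup_map_rootedSixWalks_representatives hp hq
    (rootedSixWalks_eq_of_iso ((f.trans e).trans g.symm))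
  exact hS.symm.trans hT

end DihedralGroup

/-- `D₁₀` is a 5-BCI-group. -/
theorem D10_five_BCI : IsmBCIGroup (DihedralGroup 5) 5 :=
  fun S _ => DihedralGroup.isBCIGroup_five S
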